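/- A locally confluent overlay term rewrite system R is terminating if and only if it is innermost terminating. -/

import Mathlib

namespace RWS

/-- First-order terms over a signature `F` (function symbols of arbitrary arity,
realized by lists of arguments) and variables `V`. -/
inductive Term (F V : Type) : Type
  | var : V → Term F V
  | app : F → List (Term F V) → Term F V

namespace Term

variable {F V : Type}

/-- `t` is a variable. -/
def IsVar : Term F V → Prop
  | var _ => True
  | app _ _ => False

/-- Application of a substitution (a map from variables to terms) to a term. -/
def subst (σ : V → Term F V) : Term F V → Term F V
  | var x => σ x
  | app f ts => app f (ts.attach.map fun t => t.1.subst σ)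
decreasing_by
  simp_wf
  have := List.sizeOf_lt_of_mem t.2
  omega

/-- The list of variable occurrences of a term. -/
def varOccs : Term F V → List V
  | var x => [x]
  | app _ ts => (ts.attach.map fun t => t.1.varOccs).flatten
decreasing_by
  simp_wf
  have := List.sizeOf_lt_of_mem t.2
  omega

/-- A term is linear if no variable occurs in it more than once. -/
def Linear (t : Term F V) : Prop := t.varOccs.Nodup

end Term

variable {F V : Type}

/-- `PSub t u` : `t` is a proper subterm of `u` (i.e. `u ▷ t`). -/
inductive PSub : Term F V → Term F V → Prop
  | head {t f ts} : t ∈ ts → PSub t (.app f ts)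
  | tail {t u f ts} : PSub t u → u ∈ ts → PSub t (.app f ts)

/-- Subterm-or-equal relation. -/
def Sub (t u : Term F V) : Prop := t = u ∨ PSub t u

/-- The rewrite relation of a set `R` of rewrite rules: contraction of a redex
at some position (root rule instance, closed under contexts). -/
inductive Rew (R : Set (Term F V × Term F V)) : Term F V → Term F V → Prop
  | root {l r : Term F V} {σ : V → Term F V} :
      (l, r) ∈ R → Rew R (l.subst σ) (r.subst σ)
  | congr {s t : Term F V} {f : F} {ts us : List (Term F V)} :
      Rew R s t → Rew R (.app f (ts ++ s :: us)) (.app f (ts ++ t :: us))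

/-- `t` is a normal form of `R`. -/
def NormalForm (R : Set (Term F V × Term F V)) (t : Term F V) : Prop :=
  ∀ u, ¬ Rew R t u

/-- Innermost rewriting: contraction of a redex all of whose proper subterms
are normal forms of `R`. -/
inductive IRew (R : Set (Term F V × Term F V)) : Term F V → Term F V → Prop
  | root {l r : Term F V} {σ : V → Term F V} :
      (l, r) ∈ R → (∀ u, PSub u (l.subst σ) → NormalForm R u) →
      IRew R (l.subst σ) (r.subst σ)
  | congr {s t : Term F V} {f : F} {ts us : List (Term F V)} :
      IRew R s t → IRew R (.app f (ts ++ s :: us)) (.app f (ts ++ t :: us))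

/-- A rewrite step at the root position (`→_{ε}`). -/
def RootStep (R : Set (Term F V × Term F V)) (s t : Term F V) : Prop :=
  ∃ l r σ, (l, r) ∈ R ∧ s = Term.subst σ l ∧ t = Term.subst σ r

/-- A rewrite step strictly below the root (`→_{>ε}`). -/
def BelowRew (R : Set (Term F V × Term F V)) (s t : Term F V) : Prop :=
  ∃ (f : F) (ts us : List (Term F V)) (a b : Term F V),
    Rew R a b ∧ s = .app f (ts ++ a :: us) ∧ t = .app f (ts ++ b :: us)

/-- An innermost rewrite step strictly below the root (`i→_{>ε}`). -/
def IBelowRew (R : Set (Term F V × Term F V)) (s t : Term F V) : Prop :=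
  ∃ (f : F) (ts us : List (Term F V)) (a b : Term F V),
    IRew R a b ∧ s = .app f (ts ++ a :: us) ∧ t = .app f (ts ++ b :: us)

/-- `R` is a term rewrite system: left-hand sides are not variables and
variables of right-hand sides occur in the corresponding left-hand sides. -/
def IsTRS (R : Set (Term F V × Term F V)) : Prop :=
  ∀ p ∈ R, ¬ p.1.IsVar ∧ ∀ x ∈ p.2.varOccs, x ∈ p.1.varOccs

/-- All right-hand sides are linear. -/
def RightLinear (R : Set (Term F V × Term F V)) : Prop :=
  ∀ p ∈ R, p.2.Linear

/-- No right-hand side is a variable. -/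
def NonCollapsing (R : Set (Term F V × Term F V)) : Prop :=
  ∀ p ∈ R, ¬ p.2.IsVar

/-- `R` has an inner-overlap: a proper non-variable subterm of some left-hand
side is unifiable (after renaming the rules apart, equivalently: some instance
of the one equals some instance of the other) with some left-hand side. -/
def InnerOverlap (R : Set (Term F V × Term F V)) : Prop :=
  ∃ l r l' r' u, (l, r) ∈ R ∧ (l', r') ∈ R ∧ PSub u l ∧ ¬ u.IsVar ∧
    ∃ σ τ : V → Term F V, u.subst σ = l'.subst τ

/-- `R` is an overlay system. -/
def Overlay (R : Set (Term F V × Term F V)) : Prop := ¬ InnerOverlap R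

/-- The term `t` is terminating w.r.t. `R`: no infinite rewrite sequence starts from `t`. -/
def Terminating (R : Set (Term F V × Term F V)) (t : Term F V) : Prop :=
  ¬ ∃ f : ℕ → Term F V, f 0 = t ∧ ∀ n, Rew R (f n) (f (n + 1))

/-- The TRS `R` is terminating: there is no infinite rewrite sequence. -/
def TerminatingTRS (R : Set (Term F V × Term F V)) : Prop :=
  ¬ ∃ f : ℕ → Term F V, ∀ n, Rew R (f n) (f (n + 1))

/-- The TRS `R` is innermost terminating: there is no infinite innermost rewrite sequence. -/
def InnermostTerminatingTRS (R : Set (Term F V × Term F V)) : Prop :=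
  ¬ ∃ f : ℕ → Term F V, ∀ n, IRew R (f n) (f (n + 1))

/-- Domain of a substitution. -/
def Dom (σ : V → Term F V) : Set V := {x | σ x ≠ .var x}

end RWS

namespace RWS

variable {F V : Type}

/-- Embedding of terms over the signature `F` into terms over the extended
signature `F ⊕ F`, where `Sum.inl f` is the original symbol `f` and
`Sum.inr f` is the fresh tuple symbol `f#`. -/
def Term.lift : Term F V → Term (F ⊕ F) V
  | .var x => .var x
  | .app f ts => .app (Sum.inl f) (ts.attach.map fun t => t.1.lift)
decreasing_by
  simp_wf
  have := List.sizeOf_lt_of_mem t.2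
  omega

/-- The TRS `R` viewed over the extended signature `F ⊕ F`. -/
def liftTRS (R : Set (Term F V × Term F V)) :
    Set (Term (F ⊕ F) V × Term (F ⊕ F) V) :=
  { p | ∃ l r, (l, r) ∈ R ∧ p = (l.lift, r.lift) }

/-- The defined symbols of `R`: root symbols of left-hand sides. -/
def DefinedSym (R : Set (Term F V × Term F V)) : Set F :=
  { f | ∃ ts r, (Term.app f ts, r) ∈ R }

/-- `t#`: the term `f(t₁,…,tₙ)` with its root replaced by the tuple symbol `f#`. -/
def Term.sharp : Term F V → Term (F ⊕ F) V
  | .var x => .var x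
  | .app f ts => .app (Sum.inr f) (ts.attach.map fun t => t.1.lift)

/-- The set of dependency pairs of `R`: rules `ℓ# → t#` where `ℓ → r ∈ R` and
`t` is a subterm of `r` whose root symbol is defined. -/
def DP (R : Set (Term F V × Term F V)) :
    Set (Term (F ⊕ F) V × Term (F ⊕ F) V) :=
  { p | ∃ l r t, (l, r) ∈ R ∧ Sub t r ∧
        (∃ g ts, t = Term.app g ts ∧ g ∈ DefinedSym R) ∧
        p = (l.sharp, t.sharp) }

/-- There is an infinite minimal `(P,R)`-chain
`t₀ →_{>ε,R}* s₀ →_{ε,P} t₁ →_{>ε,R}* s₁ →_{ε,P} t₂ ⋯` (all proper subterms of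
the `tᵢ` are terminating w.r.t. `R`). -/
def InfMinChain (P R : Set (Term F V × Term F V)) : Prop :=
  ∃ t s : ℕ → Term F V,
    (∀ i, Relation.ReflTransGen (BelowRew R) (t i) (s i)) ∧
    (∀ i, RootStep P (s i) (t (i + 1))) ∧
    (∀ i v, PSub v (t i) → Terminating R v)

/-- There is an infinite innermost minimal `(P,R)`-chain: as above, where the
below-root `R`-steps are innermost and each root `P`-step is applied to a term
all of whose proper subterms are normal forms of `R`. -/
def InfInnMinChain (P R : Set (Term F V × Term F V)) : Prop :=
  ∃ t s : ℕ → Term F V,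
    (∀ i, Relation.ReflTransGen (IBelowRew R) (t i) (s i)) ∧
    (∀ i v, PSub v (s i) → NormalForm R v) ∧
    (∀ i, RootStep P (s i) (t (i + 1))) ∧
    (∀ i v, PSub v (t i) → Terminating R v)

/-- Finite minimal `(P,R)`-chains of length `n` (number of root `P`-steps),
from the first term to the term reached right after the `n`-th root `P`-step. -/
inductive MinChainN (P R : Set (Term F V × Term F V)) :
    ℕ → Term F V → Term F V → Prop
  | refl {t : Term F V} :
      (∀ v, PSub v t → Terminating R v) → MinChainN P R 0 t t
  | step {n : ℕ} {t₀ t s t' : Term F V} :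
      MinChainN P R n t₀ t →
      Relation.ReflTransGen (BelowRew R) t s →
      RootStep P s t' →
      (∀ v, PSub v t' → Terminating R v) →
      MinChainN P R (n + 1) t₀ t'

/-- Finite innermost minimal `(P,R)`-chains of length `n`. -/
inductive InnMinChainN (P R : Set (Term F V × Term F V)) :
    ℕ → Term F V → Term F V → Prop
  | refl {t : Term F V} :
      (∀ v, PSub v t → Terminating R v) → InnMinChainN P R 0 t t
  | step {n : ℕ} {t₀ t s t' : Term F V} :
      InnMinChainN P R n t₀ t →
      Relation.ReflTransGen (IBelowRew R) t s →
      (∀ v, PSub v s → NormalForm R v) →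
      RootStep P s t' →
      (∀ v, PSub v t' → Terminating R v) →
      InnMinChainN P R (n + 1) t₀ t'

end RWS

namespace RWS

/-- `R` is locally confluent. -/
def LocallyConfluent {F V : Type} (R : Set (Term F V × Term F V)) : Prop :=
  ∀ t u v : Term F V, Rew R t u → Rew R t v →
    ∃ w, Relation.ReflTransGen (Rew R) u w ∧ Relation.ReflTransGen (Rew R) v w

end RWS

namespace RWS

variable {F V : Type} {R : Set (Term F V × Term F V)}

@[simp]
theorem Term.subst_var (σ : V → Term F V) (x : V) : (Term.var x).subst σ = σ x := by
  rw [Term.subst]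

@[simp]
theorem Term.subst_app (σ : V → Term F V) (f : F) (ts : List (Term F V)) :
    (Term.app f ts).subst σ = .app f (ts.map (Term.subst σ)) := by
  rw [Term.subst, List.attach_map_val (l := ts) (f := Term.subst σ)]

theorem Term.mem_varOccs_app {x : V} {f : F} {ts : List (Term F V)} :
    x ∈ (Term.app f ts).varOccs ↔ ∃ t ∈ ts, x ∈ t.varOccs := by
  rw [Term.varOccs, List.attach_map_val (l := ts) (f := Term.varOccs)]
  simp

/-- Structural induction on terms, with the hypothesis available for all direct arguments. -/
theorem Term.args_induction {P : Term F V → Prop} (var : ∀ x, P (.var x))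
    (app : ∀ f ts, (∀ t ∈ ts, P t) → P (.app f ts)) : ∀ t, P t
  | .var x => var x
  | .app f ts => app f ts fun t _ => Term.args_induction var app t
termination_by t => sizeOf t
decreasing_by
  have := List.sizeOf_lt_of_mem ‹t ∈ ts›
  simp only [Term.app.sizeOf_spec]
  omega

theorem PSub.of_mem {t u : Term F V} {f : F} {ts : List (Term F V)} (ht : t ∈ ts)
    (h : PSub (.app f ts) u) : PSub t u := by
  generalize hs : Term.app f ts = s at h
  induction h with
  | head h => subst hs; exact .tail (.head ht) h
  | tail _ h ih => exact .tail ih h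

theorem Sub.of_mem {t u : Term F V} {f : F} {ts : List (Term F V)} (ht : t ∈ ts)
    (h : Sub (.app f ts) u) : Sub t u := by
  rcases h with rfl | h
  · exact .inr (.head ht)
  · exact .inr (h.of_mem ht)

theorem Rew.rootStep_or_belowRew {s t : Term F V} (h : Rew R s t) :
    RootStep R s t ∨ BelowRew R s t := by
  cases h with
  | root h => exact .inl ⟨_, _, _, h, rfl, rfl⟩
  | congr h => exact .inr ⟨_, _, _, _, _, h, rfl, rfl⟩

theorem IRew.rew {s t : Term F V} (h : IRew R s t) : Rew R s t := by
  induction h with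
  | root h _ => exact .root h
  | congr _ ih => exact .congr ih

theorem reflTransGen_rew_of_iRew {s t : Term F V} (h : Relation.ReflTransGen (IRew R) s t) :
    Relation.ReflTransGen (Rew R) s t :=
  h.lift id fun _ _ => IRew.rew

/-- A relation on terms that is closed under contexts lifts pointwise from arguments. -/
theorem reflTransGen_app_map {r : Term F V → Term F V → Prop}
    (hr : ∀ {s t : Term F V} {f : F} {ts us : List (Term F V)},
      r s t → r (.app f (ts ++ s :: us)) (.app f (ts ++ t :: us)))
    (f : F) (g h : Term F V → Term F V) (ts us : List (Term F V))
    (H : ∀ t ∈ ts, Relation.ReflTransGen r (g t) (h t)) :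
    Relation.ReflTransGen r (.app f (us ++ ts.map g)) (.app f (us ++ ts.map h)) := by
  induction ts generalizing us with
  | nil => exact .refl
  | cons a as ih =>
    have h₁ : Relation.ReflTransGen r (.app f (us ++ g a :: as.map g))
        (.app f (us ++ h a :: as.map g)) :=
      (H a (by simp)).lift (fun x => Term.app f (us ++ x :: as.map g)) fun _ _ => hr
    have h₂ := ih (us ++ [h a]) fun t ht => H t (by simp [ht])
    simpa using h₁.trans (by simpa using h₂)

theorem reflTransGen_rew_subst {σ τ : V → Term F V}
    (h : ∀ x, Relation.ReflTransGen (Rew R) (σ x) (τ x)) (t : Term F V) :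
    Relation.ReflTransGen (Rew R) (t.subst σ) (t.subst τ) := by
  induction t using Term.args_induction with
  | var x => simpa using h x
  | app f ts ih =>
    simpa using reflTransGen_app_map Rew.congr f (Term.subst σ) (Term.subst τ) ts [] ih

theorem Sub.exists_of_iRew {u v t : Term F V} (hu : Sub u t) (h : IRew R u v) :
    ∃ t', IRew R t t' ∧ Sub v t' := by
  rcases hu with rfl | hu
  · exact ⟨v, h, .inl rfl⟩
  · induction hu with
    | head hm =>
      obtain ⟨as, bs, rfl⟩ := List.append_of_mem hm
      exact ⟨_, .congr h, .inr (.head (by simp))⟩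
    | tail _ hm ih =>
      obtain ⟨t', h₁, h₂⟩ := ih
      obtain ⟨as, bs, rfl⟩ := List.append_of_mem hm
      refine ⟨_, .congr h₁, .inr ?_⟩
      rcases h₂ with rfl | h₂
      · exact .head (by simp)
      · exact .tail h₂ (by simp)

theorem Sub.exists_of_reflTransGen_iRew {u v t : Term F V} (hu : Sub u t)
    (h : Relation.ReflTransGen (IRew R) u v) :
    ∃ t', Relation.ReflTransGen (IRew R) t t' ∧ Sub v t' := by
  induction h with
  | refl => exact ⟨t, .refl, hu⟩
  | tail _ h ih =>
    obtain ⟨t', h₁, h₂⟩ := ih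
    obtain ⟨t'', h₃, h₄⟩ := h₂.exists_of_iRew h
    exact ⟨t'', h₁.tail h₃, h₄⟩

theorem PSub.exists_of_rew {u v t : Term F V} (hu : PSub u t) (h : Rew R u v) :
    ∃ t', Rew R t t' := by
  induction hu with
  | head hm =>
    obtain ⟨as, bs, rfl⟩ := List.append_of_mem hm
    exact ⟨_, .congr h⟩
  | tail _ hm ih =>
    obtain ⟨t', h₁⟩ := ih
    obtain ⟨as, bs, rfl⟩ := List.append_of_mem hm
    exact ⟨_, .congr h₁⟩

theorem NormalForm.of_sub {u t : Term F V} (h : NormalForm R t) (hu : Sub u t) :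
    NormalForm R u := by
  rcases hu with rfl | hu
  · exact h
  · intro v hv
    obtain ⟨t', ht'⟩ := hu.exists_of_rew hv
    exact h t' ht'

theorem NormalForm.of_pSub_app {u : Term F V} {f : F} {ts : List (Term F V)}
    (h : ∀ t ∈ ts, NormalForm R t) (hu : PSub u (.app f ts)) : NormalForm R u := by
  cases hu with
  | head hm => exact h u hm
  | tail hu hm => exact (h _ hm).of_sub (.inr hu)

theorem NormalForm.eq_of_reflTransGen {t u : Term F V} (h : NormalForm R t)
    (htu : Relation.ReflTransGen (Rew R) t u) : t = u := by
  rcases htu.cases_head with h' | ⟨v, hv, _⟩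
  · exact h'
  · exact absurd hv (h v)

theorem exists_iRew_of_rew {t u : Term F V} (h : Rew R t u) : ∃ v, IRew R t v := by
  induction t using Term.args_induction generalizing u with
  | var x =>
    rcases h.rootStep_or_belowRew with ⟨l, r, σ, hR, hs, rfl⟩ | ⟨_, _, _, _, _, _, hs, _⟩
    · refine ⟨r.subst σ, hs ▸ .root hR ?_⟩
      intro v hv
      rw [← hs] at hv
      cases hv
    · cases hs
  | app f ts ih =>
    by_cases hn : ∀ t ∈ ts, NormalForm R t
    · rcases h.rootStep_or_belowRew with ⟨l, r, σ, hR, hs, rfl⟩ | ⟨_, _, _, a, b, hab, hs, _⟩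
      · refine ⟨r.subst σ, hs ▸ .root hR ?_⟩
        intro v hv
        rw [← hs] at hv
        exact .of_pSub_app hn hv
      · cases hs
        exact absurd hab (hn a (by simp) b)
    · simp only [NormalForm, not_forall, not_not] at hn
      obtain ⟨t, ht, v, hv⟩ := hn
      obtain ⟨w, hw⟩ := ih t ht hv
      obtain ⟨as, bs, rfl⟩ := List.append_of_mem ht
      exact ⟨_, .congr hw⟩

/-- Strong normalization of a single term, as accessibility. -/
def SN (R : Set (Term F V × Term F V)) (t : Term F V) : Prop :=
  Acc (fun a b => Rew R b a) t

theorem SN.of_rew {t u : Term F V} (h : SN R t) (htu : Rew R t u) : SN R u :=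
  Acc.inv h htu

theorem SN.of_pSub {t u : Term F V} (h : SN R t) (hu : PSub u t) : SN R u := by
  suffices H : ∀ t, SN R t → ∀ f as bs u, t = .app f (as ++ u :: bs) → SN R u by
    induction hu with
    | head hm =>
      obtain ⟨as, bs, rfl⟩ := List.append_of_mem hm
      exact H _ h _ _ _ _ rfl
    | tail _ hm ih =>
      obtain ⟨as, bs, rfl⟩ := List.append_of_mem hm
      exact ih (H _ h _ _ _ _ rfl)
  intro t ht
  induction ht with
  | intro t _ ih =>
    rintro f as bs u rfl
    exact Acc.intro _ fun v hv => ih _ (.congr hv) f as bs v rfl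

theorem SN.join (hLC : LocallyConfluent R) {t u v : Term F V} (h : SN R t)
    (hu : Relation.ReflTransGen (Rew R) t u) (hv : Relation.ReflTransGen (Rew R) t v) :
    Relation.Join (Relation.ReflTransGen (Rew R)) u v := by
  induction h generalizing u v with
  | intro t _ ih =>
    rcases hu.cases_head with rfl | ⟨u₁, htu, hu⟩
    · exact ⟨v, hv, .refl⟩
    rcases hv.cases_head with rfl | ⟨v₁, htv, hv⟩
    · exact ⟨u, .refl, .head htu hu⟩
    obtain ⟨w, huw, hvw⟩ := hLC t u₁ v₁ htu htv
    obtain ⟨x, hux, hwx⟩ := ih u₁ htu hu huw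
    obtain ⟨y, hxy, hvy⟩ := ih v₁ htv (hvw.trans hwx) hv
    exact ⟨y, hux.trans hxy, hvy⟩

theorem SN.normalForm_unique (hLC : LocallyConfluent R) {t u v : Term F V} (h : SN R t)
    (htu : Relation.ReflTransGen (Rew R) t u) (htv : Relation.ReflTransGen (Rew R) t v)
    (hu : NormalForm R u) (hv : NormalForm R v) : u = v := by
  obtain ⟨w, huw, hvw⟩ := h.join hLC htu htv
  rw [hu.eq_of_reflTransGen huw, hv.eq_of_reflTransGen hvw]

/-- One rewrite step in exactly one element of a list of terms. -/
def ListRew (R : Set (Term F V × Term F V)) (ss ts : List (Term F V)) : Prop :=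
  ∃ as bs a b, Rew R a b ∧ ss = as ++ a :: bs ∧ ts = as ++ b :: bs

theorem acc_listRew {ts : List (Term F V)} (h : ∀ t ∈ ts, SN R t) :
    Acc (fun a b => ListRew R b a) ts := by
  induction ts with
  | nil => exact ⟨_, fun _ ⟨as, _, _, _, _, h, _⟩ => by simp at h⟩
  | cons a as ih =>
    have has := ih fun t ht => h t (by simp [ht])
    have ha := h a (by simp)
    clear ih h
    induction ha generalizing as with
    | intro a _ iha =>
      induction has with
      | intro as hacc ihas =>
        refine ⟨_, ?_⟩
        rintro _ ⟨cs, bs, x, y, hxy, h₁, rfl⟩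
        rcases cs with _ | ⟨c, cs⟩
        · simp only [List.nil_append, List.cons.injEq] at h₁
          obtain ⟨rfl, rfl⟩ := h₁
          exact iha y hxy _ ⟨_, hacc⟩
        · simp only [List.cons_append, List.cons.injEq] at h₁
          obtain ⟨rfl, rfl⟩ := h₁
          exact ihas _ ⟨cs, bs, x, y, hxy, rfl, rfl⟩

theorem exists_normalForm_of_acc_iRew {t : Term F V} (h : Acc (fun a b => IRew R b a) t) :
    ∃ u, Relation.ReflTransGen (IRew R) t u ∧ NormalForm R u := by
  induction h with
  | intro t _ ih =>
    by_cases hn : NormalForm R t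
    · exact ⟨t, .refl, hn⟩
    · simp only [NormalForm, not_forall, not_not] at hn
      obtain ⟨v, hv⟩ := hn
      obtain ⟨w, hw⟩ := exists_iRew_of_rew hv
      obtain ⟨u, hwu, hu⟩ := ih w hw
      exact ⟨u, .head hw hwu, hu⟩

/-- In an overlay system, normalized instances of proper subterms of left-hand sides are
normal forms. -/
theorem Overlay.normalForm_subst (hOV : Overlay R) {l r u : Term F V} (hR : (l, r) ∈ R)
    (hu : PSub u l) {σ : V → Term F V} (hσ : ∀ x, NormalForm R (σ x)) :
    NormalForm R (u.subst σ) := by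
  induction u using Term.args_induction with
  | var x => simpa using hσ x
  | app f ts ih =>
    intro w hw
    rcases hw.rootStep_or_belowRew with ⟨l', r', τ, hR', hs, _⟩ | ⟨_, _, _, a, b, hab, hs, _⟩
    · exact hOV ⟨l, r, l', r', _, hR, hR', hu, id, σ, τ, hs⟩
    · rw [Term.subst_app, Term.app.injEq] at hs
      have ha : a ∈ ts.map (Term.subst σ) := by simp [hs.2]
      obtain ⟨t, ht, rfl⟩ := List.mem_map.1 ha
      exact ih t ht (hu.of_mem ht) b hab

theorem SN.var_of_subst {σ : V → Term F V} {t : Term F V} (h : SN R (t.subst σ)) {x : V}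
    (hx : x ∈ t.varOccs) : SN R (σ x) := by
  induction t using Term.args_induction with
  | var y =>
    obtain rfl : x = y := by simpa [Term.varOccs] using hx
    simpa using h
  | app f ts ih =>
    obtain ⟨t, ht, hxt⟩ := Term.mem_varOccs_app.1 hx
    refine ih t ht (h.of_pSub ?_) hxt
    rw [Term.subst_app]
    exact .head (List.mem_map_of_mem ht)

/-- If the arguments of a term are strongly normalizing, then so is the term, by induction on
innermost rewriting of a superterm of the term obtained by normalizing all arguments. -/
theorem sn_app_of_sub (hTRS : IsTRS R) (hLC : LocallyConfluent R) (hOV : Overlay R)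
    {nf : Term F V → Term F V} (hred : ∀ t, Relation.ReflTransGen (IRew R) t (nf t))
    (hnf : ∀ t, NormalForm R (nf t)) {w : Term F V}
    (hw : Acc (Relation.TransGen fun a b => IRew R b a) w) {f : F} {ts : List (Term F V)}
    (hts : ∀ t ∈ ts, SN R t) (hsub : Sub (.app f (ts.map nf)) w) : SN R (.app f ts) := by
  have hred' t : Relation.ReflTransGen (Rew R) t (nf t) := reflTransGen_rew_of_iRew (hred t)
  induction hw generalizing f ts with
  | intro w _ ihw =>
  induction acc_listRew hts with
  | intro ts _ ihts =>
  refine Acc.intro _ fun t' ht' => ?_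
  rcases ht'.rootStep_or_belowRew with ⟨l, r, σ, hR, hs, rfl⟩ | ⟨g, as, bs, a, b, hab, hs, rfl⟩
  · obtain ⟨hl, hvar⟩ := hTRS _ hR
    rcases l with x | ⟨g, ls⟩
    · exact absurd trivial hl
    rw [Term.subst_app, Term.app.injEq] at hs
    obtain ⟨rfl, rfl⟩ := hs
    have hσ : ∀ u ∈ ls, nf (u.subst σ) = u.subst (nf ∘ σ) := fun u hu =>
      (hts _ (List.mem_map_of_mem hu)).normalForm_unique hLC (hred' _)
        (reflTransGen_rew_subst (fun x => hred' (σ x)) u) (hnf _)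
        (hOV.normalForm_subst hR (.head hu) fun x => hnf _)
    have hroot : Term.app f ((ls.map (Term.subst σ)).map nf)
        = (Term.app f ls).subst (nf ∘ σ) := by
      simpa using hσ
    have hstep : IRew R (Term.app f ((ls.map (Term.subst σ)).map nf)) (r.subst (nf ∘ σ)) := by
      rw [hroot]
      refine .root hR fun u hu => ?_
      rw [← hroot] at hu
      refine .of_pSub_app (fun t ht => ?_) hu
      obtain ⟨s, _, rfl⟩ := List.mem_map.1 ht
      exact hnf s
    obtain ⟨w', hww', hw'⟩ := hsub.exists_of_iRew hstep
    have hvars : ∀ x ∈ r.varOccs, SN R (σ x) := by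
      intro x hx
      obtain ⟨t, ht, hxt⟩ := Term.mem_varOccs_app.1 (hvar x hx)
      exact (hts _ (List.mem_map_of_mem ht)).var_of_subst hxt
    clear hvar hR hstep ht'
    have key : ∀ u : Term F V, Sub (u.subst (nf ∘ σ)) w' → (∀ x ∈ u.varOccs, SN R (σ x)) →
        SN R (u.subst σ) := by
      intro u
      induction u using Term.args_induction with
      | var x =>
        intro _ h
        simpa using h x (by simp [Term.varOccs])
      | app h us ih =>
        intro hu hx
        rw [Term.subst_app] at hu
        have hus : ∀ u ∈ us, SN R (u.subst σ) := fun u hm =>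
          ih u hm (hu.of_mem (List.mem_map_of_mem hm)) fun x hxu =>
            hx x (Term.mem_varOccs_app.2 ⟨u, hm, hxu⟩)
        have hnorm := reflTransGen_app_map IRew.congr h (Term.subst (nf ∘ σ))
          (fun u => nf (u.subst σ)) us [] fun u hm => by
            have h₁ := reflTransGen_rew_subst (fun x => hred' (σ x)) u
            rw [(hus u hm).normalForm_unique hLC (hred' _) (h₁.trans (hred' _)) (hnf _) (hnf _)]
            exact hred _
        obtain ⟨w'', hw'w'', hw''⟩ := hu.exists_of_reflTransGen_iRew hnorm
        rw [Term.subst_app]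
        refine ihw w'' ?_ (by simpa using hus) (by simpa [Function.comp_def] using hw'')
        have := Relation.TransGen.head' hww' hw'w''
        exact Relation.transGen_swap.1 this
    exact key r hw' hvars
  · rw [Term.app.injEq] at hs
    obtain ⟨rfl, rfl⟩ := hs
    have ha := hts a (by simp)
    have hab' : nf a = nf b :=
      ha.normalForm_unique hLC (hred' a) (.head hab (hred' b)) (hnf _) (hnf _)
    refine ihts _ ⟨as, bs, a, b, hab, rfl, rfl⟩ ?_ (by simpa [hab'] using hsub)
    intro t ht
    rcases List.mem_append.1 ht with h | h
    · exact hts t (by simp [h])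
    · rcases List.mem_cons.1 h with rfl | h
      · exact ha.of_rew hab
      · exact hts t (by simp [h])

theorem sn_of_wellFounded_iRew (hTRS : IsTRS R) (hLC : LocallyConfluent R) (hOV : Overlay R)
    (hwf : WellFounded fun a b => IRew R b a) (t : Term F V) : SN R t := by
  choose nf hred hnf using fun t => exists_normalForm_of_acc_iRew (hwf.apply t)
  induction t using Term.args_induction with
  | var x =>
    refine ⟨_, fun u hu => ?_⟩
    rcases hu.rootStep_or_belowRew with ⟨l, r, σ, hR, hs, _⟩ | ⟨_, _, _, _, _, _, hs, _⟩
    · rcases l with y | ⟨g, ls⟩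
      · exact absurd trivial (hTRS _ hR).1
      · simp at hs
    · cases hs
  | app f ts ih =>
    exact sn_app_of_sub hTRS hLC hOV hred hnf (hwf.transGen.apply _) ih (.inl rfl)

end RWS

namespace RWS

/-- A locally confluent overlay TRS is terminating iff it is
innermost terminating. -/
theorem terminating_iff_innermostTerminating_of_locallyConfluent_overlay
    {F V : Type} {R : Set (Term F V × Term F V)}
    (hTRS : IsTRS R) (hLC : LocallyConfluent R) (hOV : Overlay R) :
    TerminatingTRS R ↔ InnermostTerminatingTRS R := by
  constructor
  · rintro h ⟨f, hf⟩
    exact h ⟨f, fun n => (hf n).rew⟩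
  · intro h
    have hwf : WellFounded fun a b => IRew R b a :=
      wellFounded_iff_isEmpty_descending_chain.2 ⟨fun f => h ⟨f.1, f.2⟩⟩
    rintro ⟨f, hf⟩
    exact (wellFounded_iff_isEmpty_descending_chain.1
      ⟨sn_of_wellFounded_iRew hTRS hLC hOV hwf⟩).false ⟨f, hf⟩

end RWS
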